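/- arXiv:1804.06663 — 5 statements merged into one kernel-verified Lean document; each statement's English description precedes it below -/
import Mathlib

section
/- An approximate block design ξ is E-optimal for treatment-control comparisons (i.e., it maximizes the smallest eigenvalue of N(ξ) over all approximate block designs) if and only if ξ(0,k) = s_k(ξ)/2 for every block k = 1,…,d and r_1(ξ) = r_2(ξ) = … = r_v(ξ) = 1/(2v). -/
open Matrix BigOperators Finset

/-- An approximate block design for `v` test treatments (labelled `1,…,v`, with
treatment `0` the control) and `d` blocks: a nonnegative weight function on
treatment-block pairs summing to one, with every block receiving positive mass. -/
structure ApproxDesign (v d : ℕ) where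
  w : Fin (v + 1) → Fin d → ℝ
  nonneg : ∀ i k, 0 ≤ w i k
  le_one : ∀ i k, w i k ≤ 1
  sum_one : ∑ i, ∑ k, w i k = 1
  blockPos : ∀ k, 0 < ∑ i, w i k

namespace ApproxDesign

variable {v d : ℕ}

/-- Block sizes `s_k(ξ)`. -/
noncomputable def s (ξ : ApproxDesign v d) (k : Fin d) : ℝ := ∑ i, ξ.w i k

/-- Treatment replications `r_i(ξ)`. -/
noncomputable def r (ξ : ApproxDesign v d) (i : Fin (v + 1)) : ℝ := ∑ k, ξ.w i k

/-- The information matrix `N(ξ) = diag(r_1,…,r_v) − Z diag(s⁻¹) Zᵀ` for comparing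
the test treatments with the control. -/
noncomputable def N (ξ : ApproxDesign v d) : Matrix (Fin v) (Fin v) ℝ :=
  Matrix.of fun i j =>
    (if i = j then ξ.r i.succ else 0) - ∑ k, ξ.w i.succ k * ξ.w j.succ k / ξ.s k

end ApproxDesign

/-- The smallest eigenvalue of a real matrix, as the infimum of its spectrum. -/
noncomputable def lamMin {n : ℕ} (A : Matrix (Fin n) (Fin n) ℝ) : ℝ :=
  sInf (spectrum ℝ A)

open scoped Pointwise in
/-- A lower bound on the spectrum of a real symmetric matrix is the same as a shifted matrix being
positive semidefinite. -/
theorem le_lamMin_iff {n : ℕ} (hn : 1 ≤ n) {A : Matrix (Fin n) (Fin n) ℝ} (hA : A.IsHermitian)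
    (c : ℝ) : c ≤ lamMin A ↔ (A - c • (1 : Matrix (Fin n) (Fin n) ℝ)).PosSemidef := by
  have : Nonempty (Fin n) := ⟨⟨0, hn⟩⟩
  have hB : (A - c • (1 : Matrix (Fin n) (Fin n) ℝ)).IsHermitian := by
    refine hA.sub ?_
    simp [Matrix.IsHermitian]
  have hspec : spectrum ℝ A - {c} = spectrum ℝ (A - c • (1 : Matrix (Fin n) (Fin n) ℝ)) := by
    rw [spectrum.sub_singleton_eq, Algebra.algebraMap_eq_smul_one]
  have hne : (spectrum ℝ A).Nonempty := by
    rw [hA.spectrum_real_eq_range_eigenvalues]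
    exact Set.range_nonempty _
  have hbdd : BddBelow (spectrum ℝ A) := A.finite_real_spectrum.bddBelow
  rw [lamMin, le_csInf_iff hbdd hne, hB.posSemidef_iff_eigenvalues_nonneg]
  constructor
  · intro h i
    have hi : hB.eigenvalues i ∈ spectrum ℝ A - {c} := by
      rw [hspec, hB.spectrum_real_eq_range_eigenvalues]
      exact ⟨i, rfl⟩
    obtain ⟨a, ha, b, rfl, hab⟩ := hi
    have := h a ha
    simp only [Pi.zero_apply, ← hab]
    linarith
  · intro h a ha
    have hi : a - c ∈ spectrum ℝ A - {c} := ⟨a, ha, c, rfl, rfl⟩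
    rw [hspec, hB.spectrum_real_eq_range_eigenvalues] at hi
    obtain ⟨i, hi⟩ := hi
    have := h i
    simp only [Pi.zero_apply, hi] at this
    linarith

namespace ApproxDesign

variable {v d : ℕ}

theorem s_pos (ξ : ApproxDesign v d) (k : Fin d) : 0 < ξ.s k := ξ.blockPos k

theorem sum_s (ξ : ApproxDesign v d) : ∑ k, ξ.s k = 1 := by
  simp only [s]
  rw [Finset.sum_comm, ξ.sum_one]

theorem sum_w_succ (ξ : ApproxDesign v d) (k : Fin d) :
    ∑ i : Fin v, ξ.w i.succ k = ξ.s k - ξ.w 0 k := by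
  rw [s, Fin.sum_univ_succ]
  ring

theorem N_isHermitian (ξ : ApproxDesign v d) : ξ.N.IsHermitian := by
  ext i j
  simp only [N, Matrix.conjTranspose_apply, Matrix.of_apply, star_trivial]
  congr 1
  · by_cases h : i = j
    · simp [h]
    · simp [h, Ne.symm h]
  · exact Finset.sum_congr rfl fun k _ => by ring

theorem N_mulVec (ξ : ApproxDesign v d) (x : Fin v → ℝ) (i : Fin v) :
    (ξ.N *ᵥ x) i =
      ξ.r i.succ * x i - ∑ k, ξ.w i.succ k * (∑ j : Fin v, ξ.w j.succ k * x j) / ξ.s k := by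
  simp only [N, Matrix.mulVec, dotProduct, Matrix.of_apply, sub_mul, Finset.sum_sub_distrib,
    ite_mul, zero_mul, Finset.sum_ite_eq, Finset.mem_univ, if_true, Finset.sum_mul,
    Finset.mul_sum, Finset.sum_div]
  rw [Finset.sum_comm]
  congr 1
  exact Finset.sum_congr rfl fun k _ => Finset.sum_congr rfl fun j _ => by ring

theorem dotProduct_N_mulVec (ξ : ApproxDesign v d) (x : Fin v → ℝ) :
    x ⬝ᵥ (ξ.N *ᵥ x) = ∑ k, (∑ i : Fin v, ξ.w i.succ k * x i ^ 2
      - (∑ i : Fin v, ξ.w i.succ k * x i) ^ 2 / ξ.s k) := by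
  simp only [dotProduct, N_mulVec, mul_sub, Finset.sum_sub_distrib]
  congr 1
  · rw [Finset.sum_comm]
    refine Finset.sum_congr rfl fun i _ => ?_
    rw [r, Finset.sum_mul, Finset.mul_sum]
    exact Finset.sum_congr rfl fun k _ => by ring
  · simp only [Finset.mul_sum (s := (Finset.univ : Finset (Fin d)))]
    rw [Finset.sum_comm]
    refine Finset.sum_congr rfl fun k _ => ?_
    rw [sq, Finset.sum_mul, Finset.sum_div]
    exact Finset.sum_congr rfl fun i _ => by ring

theorem one_dotProduct_N_mulVec_one (ξ : ApproxDesign v d) :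
    (1 : Fin v → ℝ) ⬝ᵥ (ξ.N *ᵥ 1) =
      1 / 4 - ∑ k, (ξ.w 0 k - ξ.s k / 2) ^ 2 / ξ.s k := by
  rw [dotProduct_N_mulVec, ← ξ.sum_s, Finset.sum_div, ← Finset.sum_sub_distrib]
  refine Finset.sum_congr rfl fun k _ => ?_
  have := (ξ.s_pos k).ne'
  simp only [Pi.one_apply, one_pow, mul_one, sum_w_succ]
  field_simp
  ring

theorem one_dotProduct_shift (ξ : ApproxDesign v d) (c : ℝ) :
    (1 : Fin v → ℝ) ⬝ᵥ ((ξ.N - c • (1 : Matrix (Fin v) (Fin v) ℝ)) *ᵥ 1) =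
      1 / 4 - ∑ k, (ξ.w 0 k - ξ.s k / 2) ^ 2 / ξ.s k - c * v := by
  rw [Matrix.sub_mulVec, dotProduct_sub, one_dotProduct_N_mulVec_one, Matrix.smul_mulVec,
    Matrix.one_mulVec, dotProduct_smul]
  simp [dotProduct]

theorem deviation_nonneg (ξ : ApproxDesign v d) (k : Fin d) :
    0 ≤ (ξ.w 0 k - ξ.s k / 2) ^ 2 / ξ.s k :=
  div_nonneg (sq_nonneg _) (ξ.s_pos k).le

theorem lamMin_N_le (hv : 1 ≤ v) (ξ : ApproxDesign v d) : lamMin ξ.N ≤ 1 / (4 * v) := by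
  have h := ((le_lamMin_iff hv ξ.N_isHermitian _).1 le_rfl).dotProduct_mulVec_nonneg 1
  rw [star_trivial, one_dotProduct_shift] at h
  have := Finset.sum_nonneg fun k (_ : k ∈ Finset.univ) => ξ.deviation_nonneg k
  have hv' : (0 : ℝ) < v := by exact_mod_cast hv
  rw [le_div_iff₀ (by positivity)]
  linarith

theorem le_lamMin_N (hv : 1 ≤ v) (ξ : ApproxDesign v d) (h0 : ∀ k, ξ.w 0 k = ξ.s k / 2)
    (hr : ∀ i : Fin v, ξ.r i.succ = 1 / (2 * (v : ℝ))) : 1 / (4 * (v : ℝ)) ≤ lamMin ξ.N := by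
  rw [le_lamMin_iff hv ξ.N_isHermitian, Matrix.posSemidef_iff_dotProduct_mulVec]
  refine ⟨?_, fun x => ?_⟩
  · refine ξ.N_isHermitian.sub ?_
    simp [Matrix.IsHermitian]
  have key : ∀ k, (∑ i : Fin v, ξ.w i.succ k * x i ^ 2) / 2 ≤
      ∑ i : Fin v, ξ.w i.succ k * x i ^ 2 - (∑ i : Fin v, ξ.w i.succ k * x i) ^ 2 / ξ.s k := by
    intro k
    have cs := Finset.sum_sq_le_sum_mul_sum_of_sq_le_mul Finset.univ
      (r := fun i : Fin v => ξ.w i.succ k * x i) (f := fun i : Fin v => ξ.w i.succ k)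
      (g := fun i : Fin v => ξ.w i.succ k * x i ^ 2) (fun i _ => ξ.nonneg _ _)
      (fun i _ => mul_nonneg (ξ.nonneg _ _) (sq_nonneg _)) (fun i _ => le_of_eq (by ring))
    rw [sum_w_succ, h0] at cs
    have : (∑ i : Fin v, ξ.w i.succ k * x i) ^ 2 / ξ.s k
        ≤ (∑ i : Fin v, ξ.w i.succ k * x i ^ 2) / 2 := by
      rw [div_le_iff₀ (ξ.s_pos k)]
      linarith
    linarith
  have hsum : ∑ k, (∑ i : Fin v, ξ.w i.succ k * x i ^ 2) / 2 = 1 / (4 * v) * (x ⬝ᵥ x) := by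
    rw [← Finset.sum_div, Finset.sum_comm, dotProduct, Finset.mul_sum, Finset.sum_div]
    refine Finset.sum_congr rfl fun i _ => ?_
    have := hr i
    rw [r] at this
    rw [← Finset.sum_mul, this]
    ring
  rw [star_trivial, Matrix.sub_mulVec, dotProduct_sub, dotProduct_N_mulVec, Matrix.smul_mulVec,
    Matrix.one_mulVec, dotProduct_smul, smul_eq_mul, ← hsum, sub_nonneg]
  exact Finset.sum_le_sum fun k _ => key k

theorem eq_of_le_lamMin_N (hv : 1 ≤ v) (ξ : ApproxDesign v d)
    (h : 1 / (4 * (v : ℝ)) ≤ lamMin ξ.N) :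
    (∀ k, ξ.w 0 k = ξ.s k / 2) ∧ ∀ i : Fin v, ξ.r i.succ = 1 / (2 * (v : ℝ)) := by
  have hv' : (v : ℝ) ≠ 0 := by exact_mod_cast (Nat.one_le_iff_ne_zero.1 hv)
  have hP := (le_lamMin_iff hv ξ.N_isHermitian _).1 h
  have h1 := hP.dotProduct_mulVec_nonneg 1
  have hc : 1 / (4 * (v : ℝ)) * v = 1 / 4 := by field_simp
  rw [star_trivial, one_dotProduct_shift, hc] at h1
  have hsum : ∑ k, (ξ.w 0 k - ξ.s k / 2) ^ 2 / ξ.s k = 0 :=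
    le_antisymm (by linarith) (Finset.sum_nonneg fun k _ => ξ.deviation_nonneg k)
  have h0 : ∀ k, ξ.w 0 k = ξ.s k / 2 := by
    intro k
    have := (Finset.sum_eq_zero_iff_of_nonneg fun k _ => ξ.deviation_nonneg k).1 hsum k
      (Finset.mem_univ k)
    rw [div_eq_zero_iff, or_iff_left (ξ.s_pos k).ne', sq_eq_zero_iff, sub_eq_zero] at this
    exact this
  refine ⟨h0, fun i => ?_⟩
  have hker := (hP.dotProduct_mulVec_zero_iff 1).1
    (by rw [star_trivial, one_dotProduct_shift, hc, hsum]; ring)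
  have hi := congrFun hker i
  rw [Matrix.sub_mulVec, Matrix.smul_mulVec, Matrix.one_mulVec, Pi.sub_apply, N_mulVec] at hi
  have hhalf : ∑ k, ξ.w i.succ k * (ξ.s k - ξ.s k / 2) / ξ.s k = ξ.r i.succ / 2 := by
    rw [r, Finset.sum_div]
    refine Finset.sum_congr rfl fun k _ => ?_
    have := (ξ.s_pos k).ne'
    field_simp
    ring
  simp only [Pi.one_apply, mul_one, sum_w_succ, h0, hhalf, Pi.smul_apply, smul_eq_mul,
    Pi.zero_apply] at hi
  have : 1 / (2 * (v : ℝ)) = 2 * (1 / (4 * (v : ℝ))) := by field_simp; norm_num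
  linarith

/-- The weights of the uniform product design: half of the weight on the control, the rest spread
evenly over the test treatments, and all blocks of equal size. -/
noncomputable def uniformWeight (v d : ℕ) : Fin (v + 1) → ℝ :=
  Fin.cons (1 / (2 * (d : ℝ))) fun _ => 1 / (2 * (v : ℝ) * d)

theorem uniformWeight_nonneg (v d : ℕ) (i : Fin (v + 1)) : 0 ≤ uniformWeight v d i := by
  refine Fin.cases ?_ (fun j => ?_) i
  · rw [uniformWeight, Fin.cons_zero]; positivity
  · rw [uniformWeight, Fin.cons_succ]; positivity

theorem sum_uniformWeight (hv : 1 ≤ v) (hd : 1 ≤ d) :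
    ∑ i, ∑ _k : Fin d, uniformWeight v d i = 1 := by
  have hv' : (v : ℝ) ≠ 0 := by exact_mod_cast (Nat.one_le_iff_ne_zero.1 hv)
  have hd' : (d : ℝ) ≠ 0 := by exact_mod_cast (Nat.one_le_iff_ne_zero.1 hd)
  simp only [uniformWeight, Fin.sum_univ_succ, Fin.cons_zero, Fin.cons_succ, Finset.sum_const,
    Finset.card_univ, Fintype.card_fin, nsmul_eq_mul]
  field_simp
  norm_num

/-- The uniform product design. -/
noncomputable def uniform (hv : 1 ≤ v) (hd : 1 ≤ d) : ApproxDesign v d where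
  w i _ := uniformWeight v d i
  nonneg i _ := uniformWeight_nonneg v d i
  le_one i k := calc
    uniformWeight v d i ≤ ∑ _k : Fin d, uniformWeight v d i :=
      Finset.single_le_sum (f := fun _ : Fin d => uniformWeight v d i)
        (fun _ _ => uniformWeight_nonneg v d i) (Finset.mem_univ k)
    _ ≤ ∑ i, ∑ _k : Fin d, uniformWeight v d i :=
      Finset.single_le_sum (f := fun i => ∑ _k : Fin d, uniformWeight v d i)
        (fun j _ => Finset.sum_nonneg fun _ _ => uniformWeight_nonneg v d j) (Finset.mem_univ i)
    _ = 1 := sum_uniformWeight hv hd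
  sum_one := sum_uniformWeight hv hd
  blockPos k := by
    refine lt_of_lt_of_le ?_ (Finset.single_le_sum (fun i _ => uniformWeight_nonneg v d i)
      (Finset.mem_univ 0))
    rw [uniformWeight, Fin.cons_zero]
    have : (0 : ℝ) < d := by exact_mod_cast hd
    positivity

theorem uniform_w_zero (hv : 1 ≤ v) (hd : 1 ≤ d) (k : Fin d) :
    (uniform hv hd).w 0 k = (uniform hv hd).s k / 2 := by
  have hv' : (v : ℝ) ≠ 0 := by exact_mod_cast (Nat.one_le_iff_ne_zero.1 hv)
  have hd' : (d : ℝ) ≠ 0 := by exact_mod_cast (Nat.one_le_iff_ne_zero.1 hd)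
  simp only [s, uniform, uniformWeight, Fin.sum_univ_succ, Fin.cons_zero, Fin.cons_succ,
    Finset.sum_const,
    Finset.card_univ, Fintype.card_fin, nsmul_eq_mul]
  field_simp
  norm_num

theorem uniform_r_succ (hv : 1 ≤ v) (hd : 1 ≤ d) (i : Fin v) :
    (uniform hv hd).r i.succ = 1 / (2 * (v : ℝ)) := by
  have hd' : (d : ℝ) ≠ 0 := by exact_mod_cast (Nat.one_le_iff_ne_zero.1 hd)
  simp only [r, uniform, uniformWeight, Fin.cons_succ, Finset.sum_const, Finset.card_univ,
    Fintype.card_fin,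
    nsmul_eq_mul]
  field_simp

end ApproxDesign

/-- An approximate block design `ξ` is E-optimal for treatment-control
comparisons iff `ξ(0,k) = s_k(ξ)/2` for every block `k` and
`r_1(ξ) = … = r_v(ξ) = 1/(2v)`. -/
theorem Eopt_iff {v d : ℕ} (hv : 1 ≤ v) (hd : 1 ≤ d) (ξ : ApproxDesign v d) :
    (∀ η : ApproxDesign v d, lamMin (ApproxDesign.N η) ≤ lamMin (ApproxDesign.N ξ)) ↔
      ((∀ k : Fin d, ξ.w 0 k = ξ.s k / 2) ∧
        ∀ i : Fin v, ξ.r i.succ = 1 / (2 * (v : ℝ))) := by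
  constructor
  · intro h
    exact ξ.eq_of_le_lamMin_N hv
      ((ApproxDesign.le_lamMin_N hv (.uniform hv hd) (ApproxDesign.uniform_w_zero hv hd)
        (ApproxDesign.uniform_r_succ hv hd)).trans (h _))
  · rintro ⟨h0, hr⟩ η
    exact (ApproxDesign.lamMin_N_le hv η).trans (ξ.le_lamMin_N hv h0 hr)
end

section
/- Let v ≥ 1, d ≥ 1, let s_1,…,s_d > 0 with Σ_k s_k = 1, and let ξ be the product design ξ(i,k) = r*_i s_k where r*_0 = 1/2 and r*_i = 1/(2v) for 1 ≤ i ≤ v. Then N(ξ) = (1/(2v)) I_v − (1/(4v^2)) 1_v 1_v^T; consequently the smallest eigenvalue of N(ξ) equals 1/(4v), it is attained at the eigenvector 1_v (the all-ones vector), every other eigenvalue equals 1/(2v), and for v ≥ 2 the eigenvalue 1/(4v) has multiplicity 1. -/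
open Matrix BigOperators Finset

theorem Matrix.mem_spectrum_iff_exists_mulVec {K n : Type*} [Field K] [Fintype n] [DecidableEq n]
    (A : Matrix n n K) (μ : K) :
    μ ∈ spectrum K A ↔ ∃ x : n → K, x ≠ 0 ∧ A *ᵥ x = μ • x := by
  rw [← Matrix.spectrum_toLin', ← Module.End.hasEigenvalue_iff_mem_spectrum]
  constructor
  · intro h
    obtain ⟨x, hx⟩ := h.exists_hasEigenvector
    exact ⟨x, hx.2, by simpa using hx.apply_eq_smul⟩
  · rintro ⟨x, hx, h⟩
    exact Module.End.hasEigenvalue_of_hasEigenvector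
      ⟨Module.End.mem_eigenspace_iff.2 (by simpa using h), hx⟩

theorem Matrix.smul_one_sub_smul_ones_mulVec {R n : Type*} [CommRing R] [Fintype n] [DecidableEq n]
    (a b : R) (x : n → R) :
    (a • (1 : Matrix n n R) - b • Matrix.of (fun _ _ => (1 : R))) *ᵥ x =
      fun i => a * x i - b * ∑ j, x j := by
  ext i
  rw [Matrix.sub_mulVec, Matrix.smul_mulVec, Matrix.smul_mulVec]
  simp [Matrix.mulVec, dotProduct]

theorem ApproxDesign.N_eq_of_product {v d : ℕ} (hv : 1 ≤ v)
    (s : Fin d → ℝ) (hs : ∀ k, 0 < s k) (hsum : ∑ k, s k = 1)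
    (ξ : ApproxDesign v d)
    (hξ : ∀ i k, ξ.w i k = (if i = 0 then (1 : ℝ) / 2 else 1 / (2 * (v : ℝ))) * s k) :
    ApproxDesign.N ξ =
      (1 / (2 * (v : ℝ))) • (1 : Matrix (Fin v) (Fin v) ℝ)
        - (1 / (4 * (v : ℝ) ^ 2)) • Matrix.of (fun _ _ => (1 : ℝ)) := by
  have hv0 : (v : ℝ) ≠ 0 := by positivity
  have hw : ∀ (i : Fin v) k, ξ.w i.succ k = 1 / (2 * (v : ℝ)) * s k := fun i k => by
    simp [hξ, Fin.succ_ne_zero]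
  have hsk : ∀ k, ξ.s k = s k := fun k => by
    rw [ApproxDesign.s, Fin.sum_univ_succ, hξ 0 k]
    simp only [hw, sum_const, card_univ, Fintype.card_fin, nsmul_eq_mul, if_true]
    field_simp
    ring
  have hr : ∀ i : Fin v, ξ.r i.succ = 1 / (2 * (v : ℝ)) := fun i => by
    simp only [ApproxDesign.r, hw, ← mul_sum, hsum, mul_one]
  ext i j
  have hterm : ∑ k, ξ.w i.succ k * ξ.w j.succ k / ξ.s k = 1 / (4 * (v : ℝ) ^ 2) := by
    trans ∑ k, 1 / (4 * (v : ℝ) ^ 2) * s k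
    swap
    · rw [← mul_sum, hsum, mul_one]
    refine sum_congr rfl fun k _ => ?_
    have := (hs k).ne'
    rw [hw, hw, hsk]
    field_simp
    norm_num
  simp only [ApproxDesign.N, Matrix.of_apply, hterm, hr, Matrix.sub_apply, Matrix.smul_apply,
    Matrix.one_apply, smul_eq_mul, mul_ite, mul_one, mul_zero]

/-- For the product design with control weight `1/2` and test-treatment
weights `1/(2v)`, the information matrix is `(1/(2v)) I_v − (1/(4v²)) 1_v 1_vᵀ`; its
smallest eigenvalue is `1/(4v)`, attained at the all-ones eigenvector, every other
eigenvalue is `1/(2v)`, and for `v ≥ 2` the eigenvalue `1/(4v)` has multiplicity one. -/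
theorem productDesign_N {v d : ℕ} (hv : 1 ≤ v) (hd : 1 ≤ d)
    (s : Fin d → ℝ) (hs : ∀ k, 0 < s k) (hsum : ∑ k, s k = 1)
    (ξ : ApproxDesign v d)
    (hξ : ∀ i k, ξ.w i k = (if i = 0 then (1 : ℝ) / 2 else 1 / (2 * (v : ℝ))) * s k) :
    ApproxDesign.N ξ =
      (1 / (2 * (v : ℝ))) • (1 : Matrix (Fin v) (Fin v) ℝ)
        - (1 / (4 * (v : ℝ) ^ 2)) • Matrix.of (fun _ _ => (1 : ℝ)) ∧
    lamMin (ApproxDesign.N ξ) = 1 / (4 * (v : ℝ)) ∧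
    ApproxDesign.N ξ *ᵥ (fun _ => 1) = (1 / (4 * (v : ℝ))) • (fun _ => (1 : ℝ)) ∧
    (∀ μ ∈ spectrum ℝ (ApproxDesign.N ξ),
      μ = 1 / (4 * (v : ℝ)) ∨ μ = 1 / (2 * (v : ℝ))) ∧
    (2 ≤ v →
      (1 / (2 * (v : ℝ))) ∈ spectrum ℝ (ApproxDesign.N ξ) ∧
      Module.End.eigenspace (Matrix.toLin' (ApproxDesign.N ξ)) (1 / (4 * (v : ℝ)))
        = Submodule.span ℝ {(fun _ => 1 : Fin v → ℝ)}) := by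
  have hv0 : (0 : ℝ) < v := by positivity
  have hN := ApproxDesign.N_eq_of_product hv s hs hsum ξ hξ
  have hmul : ∀ x : Fin v → ℝ, ApproxDesign.N ξ *ᵥ x =
      fun i => 1 / (2 * (v : ℝ)) * x i - 1 / (4 * (v : ℝ) ^ 2) * ∑ j, x j := fun x => by
    rw [hN, Matrix.smul_one_sub_smul_ones_mulVec]
  have hones : ApproxDesign.N ξ *ᵥ (fun _ => 1) = (1 / (4 * (v : ℝ))) • (fun _ => (1 : ℝ)) := by
    rw [hmul]
    ext i
    simp only [sum_const, card_univ, Fintype.card_fin, nsmul_eq_mul, Pi.smul_apply, smul_eq_mul]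
    field_simp
    norm_num
  have hmem : 1 / (4 * (v : ℝ)) ∈ spectrum ℝ (ApproxDesign.N ξ) :=
    (Matrix.mem_spectrum_iff_exists_mulVec _ _).2
      ⟨fun _ => 1, fun h => one_ne_zero (congrFun h ⟨0, hv⟩), hones⟩
  have hspec : ∀ μ ∈ spectrum ℝ (ApproxDesign.N ξ),
      μ = 1 / (4 * (v : ℝ)) ∨ μ = 1 / (2 * (v : ℝ)) := fun μ hμ => by
    obtain ⟨x, hx, hxμ⟩ := (Matrix.mem_spectrum_iff_exists_mulVec _ _).1 hμ
    rw [hmul] at hxμ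
    have hi : ∀ i, 1 / (2 * (v : ℝ)) * x i - 1 / (4 * (v : ℝ) ^ 2) * ∑ j, x j = μ * x i :=
      fun i => congrFun hxμ i
    by_cases hS : ∑ j, x j = 0
    · right
      obtain ⟨i, hxi⟩ := Function.ne_iff.1 hx
      have h := hi i
      rw [hS, mul_zero, sub_zero] at h
      exact (mul_right_cancel₀ hxi h).symm
    · left
      have h : ∑ i, (1 / (2 * (v : ℝ)) * x i - 1 / (4 * (v : ℝ) ^ 2) * ∑ j, x j) =
          ∑ i, μ * x i := sum_congr rfl fun i _ => hi i
      rw [sum_sub_distrib, sum_const, card_univ, Fintype.card_fin, nsmul_eq_mul,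
        ← mul_sum, ← mul_sum] at h
      refine (mul_right_cancel₀ hS (Eq.trans ?_ h)).symm
      field_simp
      norm_num
  refine ⟨hN, ?_, hones, hspec, fun hv2 => ⟨?_, ?_⟩⟩
  · refine IsLeast.csInf_eq ⟨hmem, fun μ hμ => ?_⟩
    rcases hspec μ hμ with rfl | rfl
    · exact le_rfl
    · exact one_div_le_one_div_of_le (by positivity) (by linarith)
  · refine (Matrix.mem_spectrum_iff_exists_mulVec _ _).2
      ⟨Pi.single ⟨0, by omega⟩ 1 - Pi.single ⟨1, by omega⟩ 1, fun h => ?_, ?_⟩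
    · have := congrFun h ⟨0, by omega⟩
      simp at this
    · rw [hmul]
      ext i
      simp [sum_sub_distrib]
  · ext x
    rw [Module.End.mem_eigenspace_iff, Matrix.toLin'_apply, Submodule.mem_span_singleton]
    constructor
    · intro h
      rw [hmul] at h
      refine ⟨1 / (v : ℝ) * ∑ j, x j, ?_⟩
      ext i
      have hi : 1 / (2 * (v : ℝ)) * x i - 1 / (4 * (v : ℝ) ^ 2) * ∑ j, x j =
          1 / (4 * (v : ℝ)) * x i := congrFun h i
      simp only [Pi.smul_apply, smul_eq_mul, mul_one]
      field_simp at hi ⊢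
      linarith
    · rintro ⟨c, rfl⟩
      rw [Matrix.mulVec_smul, hones, smul_comm]
end

section
/- Let ξ* be an E-optimal approximate block design for treatment-control comparisons (ξ* maximizes λ_min(N(ξ)) over all approximate block designs), with v ≥ 2. Then ξ* minimizes Σ_{i=1}^{v} (N(ξ)^{−1})_{ii} + Σ_{1 ≤ i ≠ j ≤ v} |(N(ξ)^{−1})_{ij}| over all feasible approximate block designs ξ; that is, ξ* minimizes the sum of the variances plus the sum of the absolute values of the covariances of the estimators of the treatment-control contrasts. -/
open Matrix BigOperators Finset

/-- The sum of the variances plus the sum of absolute values of the covariances of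
the treatment-control contrast estimators: `Σ_i (A⁻¹)_{ii} + Σ_{i ≠ j} |(A⁻¹)_{ij}|`. -/
noncomputable def varCovSum {n : ℕ} (A : Matrix (Fin n) (Fin n) ℝ) : ℝ :=
  ∑ i, A⁻¹ i i + ∑ i, ∑ j, if i = j then 0 else |A⁻¹ i j|

open scoped Pointwise in
theorem le_lamMin_iff_posSemidef {n : ℕ} (hn : 0 < n) {A : Matrix (Fin n) (Fin n) ℝ}
    (hA : A.IsHermitian) (c : ℝ) :
    c ≤ lamMin A ↔ (A - c • (1 : Matrix (Fin n) (Fin n) ℝ)).PosSemidef := by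
  have : Nonempty (Fin n) := ⟨⟨0, hn⟩⟩
  have hfin : (spectrum ℝ A).Finite := by
    rw [hA.spectrum_real_eq_range_eigenvalues]
    exact Set.finite_range _
  have hne : (spectrum ℝ A).Nonempty := by
    rw [hA.spectrum_real_eq_range_eigenvalues]
    exact Set.range_nonempty _
  have hB : (A - c • (1 : Matrix (Fin n) (Fin n) ℝ)).IsHermitian := by
    refine hA.sub ?_
    simp [Matrix.IsHermitian]
  have hshift : spectrum ℝ (A - c • (1 : Matrix (Fin n) (Fin n) ℝ)) =
      spectrum ℝ A - {c} := by
    rw [← Algebra.algebraMap_eq_smul_one, spectrum.sub_singleton_eq]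
  rw [lamMin, le_csInf_iff hfin.bddBelow hne, hB.posSemidef_iff_eigenvalues_nonneg]
  constructor
  · intro h i
    have hi : hB.eigenvalues i ∈ spectrum ℝ A - {c} := by
      rw [← hshift, hB.spectrum_real_eq_range_eigenvalues]
      exact ⟨i, rfl⟩
    obtain ⟨a, ha, b, rfl, hab⟩ := Set.mem_sub.1 hi
    simpa [← hab] using h a ha
  · intro h a ha
    have hi : a - c ∈ spectrum ℝ A - {c} := Set.sub_mem_sub ha rfl
    rw [← hshift, hB.spectrum_real_eq_range_eigenvalues] at hi
    obtain ⟨i, hi⟩ := hi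
    have := h i
    simp only [Pi.zero_apply, hi] at this
    linarith

namespace ApproxDesign

variable {v d : ℕ}

theorem N_apply_nonpos (ξ : ApproxDesign v d) {i j : Fin v} (h : i ≠ j) : ξ.N i j ≤ 0 := by
  simp only [N, Matrix.of_apply, if_neg h, zero_sub, neg_nonpos]
  exact Finset.sum_nonneg fun k _ =>
    div_nonneg (mul_nonneg (ξ.nonneg _ _) (ξ.nonneg _ _)) (ξ.blockPos k).le

theorem sum_N_eq (ξ : ApproxDesign v d) :
    ∑ i, ∑ j, ξ.N i j = ∑ k, (ξ.s k - ξ.w 0 k) * ξ.w 0 k / ξ.s k := by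
  have htest (k : Fin d) : ∑ i : Fin v, ξ.w i.succ k = ξ.s k - ξ.w 0 k := by
    rw [s, Fin.sum_univ_succ]; ring
  have hr : ∑ i : Fin v, ξ.r i.succ = ∑ k, (ξ.s k - ξ.w 0 k) := by
    simp only [r]
    rw [Finset.sum_comm]
    exact Finset.sum_congr rfl fun k _ => htest k
  have hZ : ∑ i : Fin v, ∑ j : Fin v, ∑ k, ξ.w i.succ k * ξ.w j.succ k / ξ.s k =
      ∑ k, (ξ.s k - ξ.w 0 k) ^ 2 / ξ.s k := by
    calc _ = ∑ i : Fin v, ∑ k, ∑ j : Fin v, ξ.w i.succ k * ξ.w j.succ k / ξ.s k :=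
          Finset.sum_congr rfl fun i _ => Finset.sum_comm
      _ = ∑ k, ∑ i : Fin v, ∑ j : Fin v, ξ.w i.succ k * ξ.w j.succ k / ξ.s k :=
          Finset.sum_comm
      _ = _ := Finset.sum_congr rfl fun k _ => by
          rw [← htest k, sq, Finset.sum_mul_sum, Finset.sum_div]
          exact Finset.sum_congr rfl fun i _ => (Finset.sum_div _ _ _).symm
  simp only [N, Matrix.of_apply, Finset.sum_sub_distrib]
  rw [hZ]
  simp only [Finset.sum_ite_eq, Finset.mem_univ, if_true]
  rw [hr, ← Finset.sum_sub_distrib]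
  refine Finset.sum_congr rfl fun k _ => ?_
  have : ξ.s k ≠ 0 := (ξ.blockPos k).ne'
  field_simp
  ring

theorem sum_N_le (ξ : ApproxDesign v d) : ∑ i, ∑ j, ξ.N i j ≤ 1 / 4 := by
  have hs : ∑ k, ξ.s k = 1 := by
    simp only [s]
    rw [Finset.sum_comm, ξ.sum_one]
  calc ∑ i, ∑ j, ξ.N i j = ∑ k, (ξ.s k - ξ.w 0 k) * ξ.w 0 k / ξ.s k := ξ.sum_N_eq
    _ ≤ ∑ k, ξ.s k / 4 := Finset.sum_le_sum fun k _ => by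
        have : 0 < ξ.s k := ξ.blockPos k
        rw [div_le_iff₀ this]
        nlinarith [sq_nonneg (ξ.s k - 2 * ξ.w 0 k)]
    _ = 1 / 4 := by rw [← Finset.sum_div, hs]

/-- The design giving half of the mass to the control and sharing the other half equally among the
test treatments, uniformly over the blocks. -/
noncomputable def balanced (hv : 0 < v) (hd : 0 < d) : ApproxDesign v d :=
  have hv' : (0 : ℝ) < v := by exact_mod_cast hv
  have hd' : (0 : ℝ) < d := by exact_mod_cast hd
  have hnonneg : ∀ (i : Fin (v + 1)) (_ : Fin d),
      (0 : ℝ) ≤ Fin.cases (motive := fun _ => ℝ) (1 / (2 * d)) (fun _ => 1 / (2 * v * d)) i := by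
    intro i k
    cases i using Fin.cases <;> simp only [Fin.cases_zero, Fin.cases_succ] <;> positivity
  have hsum : ∑ i : Fin (v + 1), ∑ _k : Fin d,
      Fin.cases (motive := fun _ => ℝ) (1 / (2 * d)) (fun _ => 1 / (2 * v * d)) i = 1 := by
    simp only [Fin.sum_univ_succ, Fin.cases_zero, Fin.cases_succ, Finset.sum_const,
      Finset.card_univ, Fintype.card_fin, nsmul_eq_mul]
    field_simp
    norm_num
  { w := fun i _ => Fin.cases (motive := fun _ => ℝ) (1 / (2 * d)) (fun _ => 1 / (2 * v * d)) i
    nonneg := hnonneg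
    le_one := fun i k => by
      refine le_trans ?_ hsum.le
      exact (Finset.single_le_sum (fun k _ => hnonneg i k) (Finset.mem_univ k)).trans
        (Finset.single_le_sum (fun i _ => Finset.sum_nonneg fun k _ => hnonneg i k)
          (Finset.mem_univ i))
    sum_one := hsum
    blockPos := fun k => by
      simp only [Fin.sum_univ_succ, Fin.cases_zero, Fin.cases_succ, Finset.sum_const,
        Finset.card_univ, Fintype.card_fin, nsmul_eq_mul]
      positivity }

theorem N_balanced_apply (hv : 0 < v) (hd : 0 < d) (i j : Fin v) :
    (balanced hv hd).N i j = (if i = j then 1 / (2 * (v : ℝ)) else 0) - 1 / (4 * (v : ℝ) ^ 2) := by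
  have hv' : (0 : ℝ) < v := by exact_mod_cast hv
  have hd' : (0 : ℝ) < d := by exact_mod_cast hd
  simp only [N, r, s, balanced, Matrix.of_apply, Fin.sum_univ_succ, Fin.cases_zero,
    Fin.cases_succ, Finset.sum_const, Finset.card_univ, Fintype.card_fin, nsmul_eq_mul]
  congr 1
  · split_ifs
    · field_simp
    · rfl
  · field_simp
    norm_num

theorem le_lamMin_N_balanced (hv : 0 < v) (hd : 0 < d) :
    1 / (4 * (v : ℝ)) ≤ lamMin (balanced hv hd).N := by
  have hv' : (0 : ℝ) < v := by exact_mod_cast hv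
  rw [le_lamMin_iff_posSemidef hv (N_isHermitian _)]
  refine Matrix.PosSemidef.of_dotProduct_mulVec_nonneg ?_ fun x => ?_
  · refine (N_isHermitian _).sub ?_
    simp [Matrix.IsHermitian]
  · have hmul : ((balanced hv hd).N - (1 / (4 * (v : ℝ))) • 1) *ᵥ x =
        fun i => 1 / (4 * (v : ℝ)) * x i - 1 / (4 * (v : ℝ) ^ 2) * ∑ j, x j := by
      ext i
      simp only [Matrix.mulVec, dotProduct, Matrix.sub_apply, Matrix.smul_apply, Matrix.one_apply,
        N_balanced_apply, sub_mul, Finset.sum_sub_distrib, ite_mul, zero_mul, smul_eq_mul,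
        mul_ite, mul_one, mul_zero, Finset.sum_ite_eq, Finset.mem_univ, if_true,
        ← Finset.mul_sum]
      field_simp
      ring
    have hcs : (∑ j, x j) ^ 2 ≤ v * ∑ j, x j ^ 2 := by
      simpa using sq_sum_le_card_mul_sum_sq (s := Finset.univ) (f := x)
    have hform : star x ⬝ᵥ (fun i => 1 / (4 * (v : ℝ)) * x i - 1 / (4 * (v : ℝ) ^ 2) * ∑ j, x j) =
        (v * ∑ j, x j ^ 2 - (∑ j, x j) ^ 2) / (4 * (v : ℝ) ^ 2) := by
      have : ∀ i, star x i * (1 / (4 * (v : ℝ)) * x i - 1 / (4 * (v : ℝ) ^ 2) * ∑ j, x j) =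
          1 / (4 * (v : ℝ)) * x i ^ 2 - x i * (1 / (4 * (v : ℝ) ^ 2) * ∑ j, x j) := by
        intro i
        simp only [Pi.star_apply, star_trivial]
        ring
      simp only [dotProduct, this, Finset.sum_sub_distrib, ← Finset.mul_sum, ← Finset.sum_mul]
      field_simp
    rw [hmul, hform]
    exact div_nonneg (sub_nonneg.2 hcs) (by positivity)

end ApproxDesign

theorem one_dotProduct_mulVec_one {n : ℕ} (A : Matrix (Fin n) (Fin n) ℝ) :
    (1 : Fin n → ℝ) ⬝ᵥ A *ᵥ 1 = ∑ i, ∑ j, A i j := by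
  simp [dotProduct, Matrix.mulVec]

theorem sum_entries_inv_le_varCovSum {n : ℕ} (A : Matrix (Fin n) (Fin n) ℝ) :
    ∑ i, ∑ j, A⁻¹ i j ≤ varCovSum A := by
  rw [varCovSum, ← Finset.sum_add_distrib]
  refine Finset.sum_le_sum fun i _ => ?_
  calc ∑ j, A⁻¹ i j ≤ ∑ j, ((if i = j then A⁻¹ i i else 0) + if i = j then 0 else |A⁻¹ i j|) :=
        Finset.sum_le_sum fun j _ => by
          split_ifs with h
          · simp [h]
          · simpa [h] using le_abs_self (A⁻¹ i j)
    _ = _ := by simp [Finset.sum_add_distrib]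

theorem varCovSum_eq_sum_entries_inv {n : ℕ} {A : Matrix (Fin n) (Fin n) ℝ}
    (h : ∀ i j, 0 ≤ A⁻¹ i j) : varCovSum A = ∑ i, ∑ j, A⁻¹ i j := by
  rw [varCovSum, ← Finset.sum_add_distrib]
  refine Finset.sum_congr rfl fun i _ => ?_
  calc _ = ∑ j, ((if i = j then A⁻¹ i i else 0) + if i = j then 0 else |A⁻¹ i j|) := by
        simp [Finset.sum_add_distrib]
    _ = _ := Finset.sum_congr rfl fun j _ => by
        split_ifs with h'
        · simp [h']
        · simp [abs_of_nonneg (h i j)]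

/-- A matrix with nonpositive off-diagonal entries and constant positive row sums is monotone. -/
theorem nonneg_of_mulVec_nonneg {n : ℕ} {A : Matrix (Fin n) (Fin n) ℝ} {c : ℝ} (hc : 0 < c)
    (hoff : ∀ i j, i ≠ j → A i j ≤ 0) (hrow : A *ᵥ 1 = c • (1 : Fin n → ℝ))
    {x : Fin n → ℝ} (hx : ∀ i, 0 ≤ (A *ᵥ x) i) (i : Fin n) : 0 ≤ x i := by
  have : Nonempty (Fin n) := ⟨i⟩
  obtain ⟨m, hm⟩ := Finite.exists_min x
  refine le_trans ?_ (hm i)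
  have hle : (A *ᵥ x) m ≤ c * x m := by
    have hr : ∑ j, A m j = c := by simpa [Matrix.mulVec, dotProduct] using congrFun hrow m
    rw [← hr, Finset.sum_mul, Matrix.mulVec, dotProduct]
    refine Finset.sum_le_sum fun j _ => ?_
    rcases eq_or_ne m j with rfl | h
    · exact le_rfl
    · exact mul_le_mul_of_nonpos_left (hm j) (hoff m j h)
  exact (mul_nonneg_iff_of_pos_left hc).1 ((hx m).trans hle)

theorem inv_nonneg_of_row_sums {n : ℕ} {A : Matrix (Fin n) (Fin n) ℝ} {c : ℝ} (hc : 0 < c)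
    (hA : IsUnit A.det) (hoff : ∀ i j, i ≠ j → A i j ≤ 0)
    (hrow : A *ᵥ 1 = c • (1 : Fin n → ℝ)) (i j : Fin n) : 0 ≤ A⁻¹ i j := by
  refine nonneg_of_mulVec_nonneg (x := fun k => A⁻¹ k j) hc hoff hrow (fun k => ?_) i
  have : (A *ᵥ fun k => A⁻¹ k j) k = (A * A⁻¹) k j := rfl
  rw [this, Matrix.mul_nonsing_inv _ hA, Matrix.one_apply]
  split_ifs <;> norm_num

theorem Matrix.PosDef.le_sum_entries_inv {n : ℕ} {A : Matrix (Fin n) (Fin n) ℝ} (hA : A.PosDef)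
    (t : ℝ) : 2 * t * n - t ^ 2 * ∑ i, ∑ j, A i j ≤ ∑ i, ∑ j, A⁻¹ i j := by
  have hdet : IsUnit A.det := hA.det_pos.ne'.isUnit
  have hsymm : Aᵀ = A := by simpa using hA.isHermitian.eq
  have h := hA.posSemidef.dotProduct_mulVec_nonneg (A⁻¹ *ᵥ 1 - t • 1)
  have hinv : A *ᵥ (A⁻¹ *ᵥ 1) = 1 := by
    rw [Matrix.mulVec_mulVec, Matrix.mul_nonsing_inv _ hdet, Matrix.one_mulVec]
  have hcross : (A⁻¹ *ᵥ 1) ⬝ᵥ (A *ᵥ 1) = (1 : Fin n → ℝ) ⬝ᵥ 1 := by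
    rw [Matrix.dotProduct_mulVec, ← Matrix.mulVec_transpose, hsymm, hinv]
  have hone : (1 : Fin n → ℝ) ⬝ᵥ 1 = n := by simp
  rw [star_trivial, Matrix.mulVec_sub, Matrix.mulVec_smul, hinv] at h
  simp only [sub_dotProduct, dotProduct_sub, smul_dotProduct, dotProduct_smul, smul_eq_mul,
    hcross, hone, one_dotProduct_mulVec_one] at h
  rw [dotProduct_comm, one_dotProduct_mulVec_one] at h
  linarith

/-- An E-optimal approximate block design (`v ≥ 2`) minimizes the sum of
the variances plus the sum of the absolute values of the covariances of the estimators
of the treatment-control contrasts over all feasible approximate block designs. -/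
theorem Eopt_minimizes_varCovSum {v d : ℕ} (hv : 2 ≤ v) (hd : 1 ≤ d)
    (ξs : ApproxDesign v d)
    (hopt : ∀ η : ApproxDesign v d,
      lamMin (ApproxDesign.N η) ≤ lamMin (ApproxDesign.N ξs)) :
    (ApproxDesign.N ξs).PosDef ∧
    ∀ ξ : ApproxDesign v d, (ApproxDesign.N ξ).PosDef →
      varCovSum (ApproxDesign.N ξs) ≤ varCovSum (ApproxDesign.N ξ) := by
  have hv0 : 0 < v := by omega
  have hv' : (0 : ℝ) < v := by exact_mod_cast hv0
  have hc : 0 < 1 / (4 * (v : ℝ)) := by positivity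
  have hpsd : (ξs.N - (1 / (4 * (v : ℝ))) • (1 : Matrix (Fin v) (Fin v) ℝ)).PosSemidef :=
    (le_lamMin_iff_posSemidef hv0 ξs.N_isHermitian _).1
      ((ApproxDesign.le_lamMin_N_balanced hv0 hd).trans (hopt _))
  have hpd : ξs.N.PosDef := by
    have := Matrix.PosDef.posSemidef_add hpsd ((Matrix.PosDef.one (n := Fin v) (R := ℝ)).smul hc)
    simpa using this
  have hrow : ξs.N *ᵥ 1 = (1 / (4 * (v : ℝ))) • (1 : Fin v → ℝ) := by
    have hsplit : (ξs.N - (1 / (4 * (v : ℝ))) • (1 : Matrix (Fin v) (Fin v) ℝ)) *ᵥ 1 =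
        ξs.N *ᵥ 1 - (1 / (4 * (v : ℝ))) • (1 : Fin v → ℝ) := by
      rw [Matrix.sub_mulVec, Matrix.smul_mulVec, Matrix.one_mulVec]
    have hform : star (1 : Fin v → ℝ) ⬝ᵥ
        (ξs.N - (1 / (4 * (v : ℝ))) • (1 : Matrix (Fin v) (Fin v) ℝ)) *ᵥ 1 =
        ∑ i, ∑ j, ξs.N i j - 1 / 4 := by
      rw [hsplit, star_trivial, dotProduct_sub, one_dotProduct_mulVec_one]
      simp only [dotProduct_smul, one_dotProduct_one, Fintype.card_fin, smul_eq_mul]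
      field_simp
    have hzero := (hpsd.dotProduct_mulVec_zero_iff 1).1 <| le_antisymm
      (hform.le.trans (by linarith [ξs.sum_N_le])) (hpsd.dotProduct_mulVec_nonneg 1)
    rw [hsplit] at hzero
    exact sub_eq_zero.1 hzero
  refine ⟨hpd, fun ξ hξ => ?_⟩
  have hdet : IsUnit ξs.N.det := hpd.det_pos.ne'.isUnit
  have hinv : ξs.N⁻¹ *ᵥ 1 = (4 * (v : ℝ)) • (1 : Fin v → ℝ) := by
    have h1 : (1 : Fin v → ℝ) = ξs.N *ᵥ ((4 * (v : ℝ)) • (1 : Fin v → ℝ)) := by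
      rw [Matrix.mulVec_smul, hrow, smul_smul, mul_one_div_cancel (by positivity), one_smul]
    conv_lhs => rw [h1]
    rw [Matrix.mulVec_mulVec, Matrix.nonsing_inv_mul _ hdet, Matrix.one_mulVec]
  calc varCovSum ξs.N = ∑ i, ∑ j, ξs.N⁻¹ i j := varCovSum_eq_sum_entries_inv
        (inv_nonneg_of_row_sums hc hdet (fun i j h => ξs.N_apply_nonpos h) hrow)
    _ = 4 * (v : ℝ) ^ 2 := by
        rw [← one_dotProduct_mulVec_one, hinv]
        simp only [dotProduct_smul, one_dotProduct_one, Fintype.card_fin, smul_eq_mul]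
        ring
    _ ≤ 2 * (4 * (v : ℝ)) * v - (4 * (v : ℝ)) ^ 2 * ∑ i, ∑ j, ξ.N i j := by
        nlinarith [mul_le_mul_of_nonneg_left ξ.sum_N_le (sq_nonneg (4 * (v : ℝ)))]
    _ ≤ ∑ i, ∑ j, ξ.N⁻¹ i j := hξ.le_sum_entries_inv _
    _ ≤ varCovSum ξ.N := sum_entries_inv_le_varCovSum _
end

section
/- Let N be a real symmetric positive definite v × v matrix and let N̄ := (1/v!) Σ_π P_π N P_π^T, where the sum ranges over all permutations π of {1,…,v} and P_π denotes the corresponding v × v permutation matrix. Then N̄ is symmetric positive definite and completely symmetric (of the form a I_v + b J_v with J_v the all-ones matrix), and Π_{i=1}^{v} (N̄^{−1})_{ii} ≤ Π_{i=1}^{v} (N^{−1})_{ii}. -/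
open Matrix BigOperators

/-- The average `N̄ = (1/v!) Σ_π P_π N P_πᵀ` of a matrix over all simultaneous
permutations of its rows and columns. -/
noncomputable def permAvg {v : ℕ} (N : Matrix (Fin v) (Fin v) ℝ) :
    Matrix (Fin v) (Fin v) ℝ :=
  ((Nat.factorial v : ℝ))⁻¹ • ∑ π : Equiv.Perm (Fin v), N.submatrix ⇑π ⇑π

/-- Cauchy-Schwarz for the form of `A` between `x` and the `i`-th column of `A⁻¹`. -/
theorem Matrix.PosDef.sq_apply_le_inv_diag_mul {n : Type*} [Fintype n] [DecidableEq n]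
    {A : Matrix n n ℝ} (hA : A.PosDef) (x : n → ℝ) (i : n) :
    x i ^ 2 ≤ A⁻¹ i i * (x ⬝ᵥ A *ᵥ x) := by
  have hd : 0 < A⁻¹ i i := hA.inv.diag_pos
  have hAu : A *ᵥ (A⁻¹ *ᵥ Pi.single i 1) = Pi.single i 1 := by
    rw [mulVec_mulVec, mul_nonsing_inv _ ((isUnit_iff_isUnit_det A).1 hA.isUnit), one_mulVec]
  have hui : (A⁻¹ *ᵥ Pi.single i 1) i = A⁻¹ i i := by simp
  generalize A⁻¹ *ᵥ Pi.single i 1 = u at hAu hui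
  have hsymm : u ⬝ᵥ A *ᵥ x = x i := by
    have hT : Aᵀ = A := by simpa using hA.isHermitian.eq
    rw [dotProduct_mulVec, ← mulVec_transpose, hT, hAu, single_one_dotProduct]
  have h := hA.posSemidef.dotProduct_mulVec_nonneg (A⁻¹ i i • x - x i • u)
  simp only [star_trivial, mulVec_sub, mulVec_smul, hAu, sub_dotProduct, dotProduct_sub,
    smul_dotProduct, dotProduct_smul, hsymm, dotProduct_single_one, Pi.sub_apply,
    Pi.smul_apply, hui, smul_eq_mul] at h
  have h' : 0 ≤ A⁻¹ i i * (A⁻¹ i i * (x ⬝ᵥ A *ᵥ x) - x i ^ 2) := by linarith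
  linarith [nonneg_of_mul_nonneg_right h' hd]

theorem Equiv.exists_perm_apply_eq_apply_eq {α : Type*} {i j k l : α}
    (hij : i ≠ j) (hkl : k ≠ l) : ∃ σ : Equiv.Perm α, σ i = k ∧ σ j = l := by
  classical
  refine ⟨Equiv.swap (Equiv.swap i k j) l * Equiv.swap i k, ?_, by simp⟩
  rw [Equiv.Perm.mul_apply, Equiv.swap_apply_left, Equiv.swap_apply_of_ne_of_ne _ hkl]
  exact fun h => hij ((Equiv.swap i k).injective ((Equiv.swap_apply_left i k).trans h))

/-- A matrix invariant under simultaneous permutations of rows and columns is completely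
symmetric. -/
theorem Matrix.exists_eq_smul_one_add_smul_of_submatrix_perm {n R : Type*} [DecidableEq n]
    [Ring R] {M : Matrix n n R} (hM : ∀ σ : Equiv.Perm n, M.submatrix σ σ = M) :
    ∃ a b : R, M = a • (1 : Matrix n n R) + b • Matrix.of (fun _ _ => (1 : R)) := by
  have happ (σ : Equiv.Perm n) (i j : n) : M (σ i) (σ j) = M i j := congr_fun₂ (hM σ) i j
  rcases isEmpty_or_nonempty n with _ | ⟨⟨o⟩⟩
  · exact ⟨0, 0, Subsingleton.elim _ _⟩
  have hdiag (i : n) : M i i = M o o := by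
    simpa using happ (Equiv.swap o i) o o
  by_cases h : ∃ k l : n, k ≠ l
  · obtain ⟨k, l, hkl⟩ := h
    refine ⟨M o o - M k l, M k l, ?_⟩
    ext i j
    by_cases hij : i = j
    · subst hij
      simp [hdiag i]
    · obtain ⟨σ, rfl, rfl⟩ := Equiv.exists_perm_apply_eq_apply_eq hkl hij
      simp [happ, hkl]
  · push Not at h
    refine ⟨M o o, 0, ?_⟩
    ext i j
    simp [h i o, h j o]

theorem permAvg_submatrix_perm {v : ℕ} (N : Matrix (Fin v) (Fin v) ℝ)
    (σ : Equiv.Perm (Fin v)) : (permAvg N).submatrix σ σ = permAvg N := by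
  ext i j
  simp only [permAvg, submatrix_apply, Matrix.smul_apply, Matrix.sum_apply]
  congr 1
  exact Equiv.sum_comp (Equiv.mulRight σ) fun π : Equiv.Perm (Fin v) => N (π i) (π j)

theorem Matrix.PosDef.permAvg {v : ℕ} {N : Matrix (Fin v) (Fin v) ℝ} (hN : N.PosDef) :
    (permAvg N).PosDef :=
  (posDef_sum Finset.univ_nonempty fun π _ => hN.submatrix π.injective).smul
    (inv_pos.2 (Nat.cast_pos.2 v.factorial_pos))

/-- The reciprocal of a diagonal entry of the inverse is concave under permutation averaging. -/
theorem sum_inv_inv_diag_le_inv_permAvg_inv_diag {v : ℕ} {N : Matrix (Fin v) (Fin v) ℝ}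
    (hN : N.PosDef) (i : Fin v) :
    ∑ π : Equiv.Perm (Fin v), ((v.factorial : ℝ))⁻¹ * (N⁻¹ (π i) (π i))⁻¹ ≤
      ((permAvg N)⁻¹ i i)⁻¹ := by
  have hM := hN.permAvg
  have hd : 0 < (permAvg N)⁻¹ i i := hM.inv.diag_pos
  have hMx : permAvg N *ᵥ ((permAvg N)⁻¹ *ᵥ Pi.single i 1) = Pi.single i 1 := by
    rw [mulVec_mulVec, mul_nonsing_inv _ ((isUnit_iff_isUnit_det _).1 hM.isUnit), one_mulVec]
  have hxi : ((permAvg N)⁻¹ *ᵥ Pi.single i 1) i = (permAvg N)⁻¹ i i := by simp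
  generalize (permAvg N)⁻¹ *ᵥ Pi.single i 1 = x at hMx hxi
  have hterm (π : Equiv.Perm (Fin v)) :
      (permAvg N)⁻¹ i i ^ 2 * (N⁻¹ (π i) (π i))⁻¹ ≤ x ⬝ᵥ N.submatrix π π *ᵥ x := by
    have h := (hN.submatrix π.injective).sq_apply_le_inv_diag_mul x i
    rw [inv_submatrix_equiv, submatrix_apply, hxi] at h
    rw [← div_eq_mul_inv, div_le_iff₀ hN.inv.diag_pos]
    linarith
  have hsum : ((v.factorial : ℝ))⁻¹ * ∑ π : Equiv.Perm (Fin v), x ⬝ᵥ N.submatrix π π *ᵥ x =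
      (permAvg N)⁻¹ i i := by
    rw [← hxi, ← dotProduct_single_one x i, ← hMx, permAvg, smul_mulVec, sum_mulVec,
      dotProduct_smul, dotProduct_sum, smul_eq_mul]
  have hle : (permAvg N)⁻¹ i i ^ 2 *
      ∑ π : Equiv.Perm (Fin v), ((v.factorial : ℝ))⁻¹ * (N⁻¹ (π i) (π i))⁻¹ ≤
      (permAvg N)⁻¹ i i := by
    calc _ = ((v.factorial : ℝ))⁻¹ *
          ∑ π : Equiv.Perm (Fin v), (permAvg N)⁻¹ i i ^ 2 * (N⁻¹ (π i) (π i))⁻¹ := by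
          simp only [← Finset.mul_sum]
          ring
      _ ≤ ((v.factorial : ℝ))⁻¹ * ∑ π : Equiv.Perm (Fin v), x ⬝ᵥ N.submatrix π π *ᵥ x := by
          gcongr with π
          exact hterm π
      _ = _ := hsum
  rw [inv_eq_one_div ((permAvg N)⁻¹ i i), le_div_iff₀ hd]
  refine le_of_mul_le_mul_left ?_ hd
  linarith

/-- The geometric mean is at most the arithmetic mean over permutations, multiplied over all
coordinates. -/
theorem prod_le_prod_sum_perm {n : Type*} [Fintype n] [DecidableEq n] {g : n → ℝ}
    (hg : ∀ i, 0 ≤ g i) :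
    ∏ i, g i ≤
      ∏ i, ∑ π : Equiv.Perm n, (((Fintype.card n).factorial : ℝ))⁻¹ * g (π i) := by
  have hne : (((Fintype.card n).factorial : ℝ)) ≠ 0 :=
    Nat.cast_ne_zero.2 (Nat.factorial_ne_zero _)
  have hG : 0 ≤ ∏ i, g i := Finset.prod_nonneg fun i _ => hg i
  calc ∏ i, g i
      = ∏ i, ∏ π : Equiv.Perm n, g (π i) ^ (((Fintype.card n).factorial : ℝ))⁻¹ := by
        rw [Finset.prod_comm]
        simp_rw [Real.finsetProd_rpow _ _ (fun i _ => hg _), Equiv.prod_comp _ g]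
        rw [Finset.prod_const, Finset.card_univ, Fintype.card_perm, Real.rpow_inv_natCast_pow hG
          (Nat.factorial_ne_zero _)]
    _ ≤ _ := by
        refine Finset.prod_le_prod
          (fun i _ => Finset.prod_nonneg fun π _ => Real.rpow_nonneg (hg _) _) fun i _ => ?_
        refine Real.geom_mean_le_arith_mean_weighted Finset.univ
          (fun _ => (((Fintype.card n).factorial : ℝ))⁻¹) (fun π : Equiv.Perm n => g (π i))
          (fun _ _ => by positivity) ?_ (fun π _ => hg _)
        rw [Finset.sum_const, Finset.card_univ, Fintype.card_perm, nsmul_eq_mul,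
          mul_inv_cancel₀ hne]

/-- For a real symmetric positive definite `N`, the permutation average
`N̄ = (1/v!) Σ_π P_π N P_πᵀ` is positive definite and completely symmetric
(`N̄ = a I_v + b J_v`), and `Π_i (N̄⁻¹)_{ii} ≤ Π_i (N⁻¹)_{ii}`. -/
theorem permAvg_prod_diag_le {v : ℕ} (hv : 1 ≤ v)
    (N : Matrix (Fin v) (Fin v) ℝ) (hN : N.PosDef) :
    (permAvg N).PosDef ∧
    (∃ a b : ℝ, permAvg N =
      a • (1 : Matrix (Fin v) (Fin v) ℝ) + b • Matrix.of (fun _ _ => (1 : ℝ))) ∧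
    ∏ i, (permAvg N)⁻¹ i i ≤ ∏ i, N⁻¹ i i := by
  refine ⟨hN.permAvg, exists_eq_smul_one_add_smul_of_submatrix_perm (permAvg_submatrix_perm N), ?_⟩
  have hpos (i : Fin v) : 0 < N⁻¹ i i := hN.inv.diag_pos
  have hAM := prod_le_prod_sum_perm fun i => (inv_pos.2 (hpos i)).le
  rw [Fintype.card_fin] at hAM
  have h : ∏ i, (N⁻¹ i i)⁻¹ ≤ ∏ i, ((permAvg N)⁻¹ i i)⁻¹ :=
    hAM.trans (Finset.prod_le_prod
      (fun i _ => Finset.sum_nonneg fun π _ =>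
        mul_nonneg (by positivity) (inv_pos.2 (hpos (π i))).le)
      fun i _ => sum_inv_inv_diag_le_inv_permAvg_inv_diag hN i)
  rw [Finset.prod_inv_distrib, Finset.prod_inv_distrib] at h
  exact (inv_le_inv₀ (Finset.prod_pos fun i _ => hpos i)
    (Finset.prod_pos fun i _ => hN.permAvg.inv.diag_pos)).1 h
end

section
/- Let q ≥ 2 and let ξ ∈ D(v,d,q·1_d) satisfy ξ(0,k) = ⌊q/2⌋ for every block k, ξ(i,k) ∈ {0,1} for all 1 ≤ i ≤ v and all k, and r_1(ξ) = … = r_v(ξ). Then μ_{01}(ξ) = μ_{02}(ξ) = … = μ_{0v}(ξ) (each equal to ⌊q/2⌋·r_1(ξ)), and consequently ξ is E-optimal for treatment-control comparisons in D(v,d,q·1_d). -/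
open Matrix BigOperators Finset

/-- An exact block design in `D(v,d,m)`: `v` test treatments (labelled `1,…,v`, with
treatment `0` the control), `d` blocks of sizes `m_1,…,m_d`; `w i k` is the number of
trials of treatment `i` in block `k`. -/
structure ExactDesign (v d : ℕ) (m : Fin d → ℕ) where
  w : Fin (v + 1) → Fin d → ℕ
  block_sum : ∀ k, ∑ i, w i k = m k

namespace ExactDesign

variable {v d : ℕ} {m : Fin d → ℕ}

/-- Treatment replications `r_i(ξ)`. -/
def r (ξ : ExactDesign v d m) (i : Fin (v + 1)) : ℕ := ∑ k, ξ.w i k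

/-- Concurrences `μ_{ij}(ξ) = Σ_k ξ(i,k) ξ(j,k)`. -/
def mu (ξ : ExactDesign v d m) (i j : Fin (v + 1)) : ℕ := ∑ k, ξ.w i k * ξ.w j k

/-- The information matrix `N(ξ) = diag(r_1,…,r_v) − Z diag(m⁻¹) Zᵀ` for comparing
the test treatments with the control. -/
noncomputable def N (ξ : ExactDesign v d m) : Matrix (Fin v) (Fin v) ℝ :=
  Matrix.of fun i j =>
    (if i = j then (ξ.r i.succ : ℝ) else 0)
      - ∑ k, (ξ.w i.succ k : ℝ) * (ξ.w j.succ k : ℝ) / (m k : ℝ)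

end ExactDesign

/-- The smallest eigenvalue of a symmetric real matrix is at most the average of its row sums. -/
theorem lamMin_mul_card_le_sum {n : ℕ} {A : Matrix (Fin n) (Fin n) ℝ} (hA : A.IsHermitian) :
    lamMin A * n ≤ ∑ i, ∑ j, A i j := by
  have hbdd : BddBelow (spectrum ℝ A) := (Matrix.finite_real_spectrum (A := A)).bddBelow
  have hpsd : (A - algebraMap ℝ (Matrix (Fin n) (Fin n) ℝ) (lamMin A)).PosSemidef := by
    rw [Matrix.posSemidef_iff_isHermitian_and_spectrum_nonneg]
    refine ⟨hA.sub ?_, fun x hx => ?_⟩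
    · rw [Matrix.algebraMap_eq_diagonal]
      exact Matrix.isHermitian_diagonal _
    · rw [← spectrum.sub_singleton_eq] at hx
      obtain ⟨y, hy, z, rfl, rfl⟩ := hx
      exact sub_nonneg.2 (csInf_le hbdd hy)
  have h := hpsd.dotProduct_mulVec_nonneg (fun _ => 1)
  simp only [dotProduct, mulVec, Pi.star_apply, star_one, one_mul, mul_one, Matrix.sub_apply,
    Matrix.algebraMap_matrix_apply, Finset.sum_sub_distrib, Finset.sum_ite_eq, Finset.mem_univ,
    if_true, Finset.sum_const, Finset.card_univ, Fintype.card_fin, nsmul_eq_mul,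
    Algebra.algebraMap_self_apply] at h
  linarith

/-- If a real matrix has nonpositive off-diagonal entries and all its row sums equal `c`, then
its smallest eigenvalue is `c`. -/
theorem lamMin_eq_of_row_sums {n : ℕ} [NeZero n] {A : Matrix (Fin n) (Fin n) ℝ} {c : ℝ}
    (hoff : ∀ i j, i ≠ j → A i j ≤ 0) (hrow : ∀ i, ∑ j, A i j = c) : lamMin A = c := by
  have hmem : c ∈ spectrum ℝ A := by
    rw [← Matrix.spectrum_toLin', ← Module.End.hasEigenvalue_iff_mem_spectrum]
    refine Module.End.hasEigenvalue_of_hasEigenvector (x := fun _ => 1)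
      ⟨Module.End.mem_eigenspace_iff.2 ?_, fun h => ?_⟩
    · ext i
      simpa [mulVec, dotProduct] using hrow i
    · simpa using congrFun h 0
  have hlb : ∀ x ∈ spectrum ℝ A, c ≤ x := by
    intro x hx
    rw [← Matrix.spectrum_toLin', ← Module.End.hasEigenvalue_iff_mem_spectrum] at hx
    obtain ⟨k, hk⟩ := eigenvalue_mem_ball hx
    have hnorm : ∑ j ∈ Finset.univ.erase k, ‖A k j‖ = A k k - c := by
      rw [← hrow k, ← Finset.add_sum_erase _ _ (Finset.mem_univ k), sub_add_cancel_left,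
        ← Finset.sum_neg_distrib]
      refine Finset.sum_congr rfl fun j hj => ?_
      rw [Real.norm_eq_abs, abs_of_nonpos (hoff k j (Finset.ne_of_mem_erase hj).symm)]
    rw [hnorm, Metric.mem_closedBall, Real.dist_eq] at hk
    linarith [neg_le_of_abs_le hk]
  exact le_antisymm (csInf_le ⟨c, hlb⟩ hmem) (le_csInf ⟨c, hmem⟩ hlb)

namespace ExactDesign

variable {v d q : ℕ}

theorem isHermitian_N {m : Fin d → ℕ} (ξ : ExactDesign v d m) : ξ.N.IsHermitian := by
  ext i j
  simp only [N, conjTranspose_apply, Matrix.of_apply, star_trivial, eq_comm (a := j) (b := i)]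
  congr 1
  · split_ifs with h
    · rw [h]
    · rfl
  · simp only [mul_comm]

theorem N_nonpos_of_ne {m : Fin d → ℕ} (ξ : ExactDesign v d m) {i j : Fin v} (hij : i ≠ j) :
    ξ.N i j ≤ 0 := by
  simp only [N, Matrix.of_apply, if_neg hij, zero_sub, Left.neg_nonpos_iff]
  positivity

theorem sum_test_eq {m : Fin d → ℕ} (ξ : ExactDesign v d m) (k : Fin d) :
    ∑ i : Fin v, (ξ.w i.succ k : ℝ) = m k - ξ.w 0 k := by
  have h := ξ.block_sum k
  rw [Fin.sum_univ_succ] at h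
  rw [← h]
  push_cast
  ring

/-- The row sums of the information matrix are the concurrences with the control, divided by
the common block size. -/
theorem sum_N_row (hq : q ≠ 0) (ξ : ExactDesign v d (fun _ => q)) (i : Fin v) :
    ∑ j, ξ.N i j = (ξ.mu 0 i.succ : ℝ) / q := by
  have hq' : (q : ℝ) ≠ 0 := Nat.cast_ne_zero.2 hq
  simp only [N, Matrix.of_apply, Finset.sum_sub_distrib, Finset.sum_ite_eq, Finset.mem_univ,
    if_true]
  rw [Finset.sum_comm]
  simp only [← Finset.sum_div, ← Finset.mul_sum, sum_test_eq, r, mu, Nat.cast_sum, Nat.cast_mul]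
  rw [eq_div_iff hq', sub_mul, div_mul_cancel₀ _ hq', Finset.sum_mul, ← Finset.sum_sub_distrib]
  exact Finset.sum_congr rfl fun k _ => by ring

theorem sum_mu_control {m : Fin d → ℕ} (ξ : ExactDesign v d m) :
    ∑ i : Fin v, (ξ.mu 0 i.succ : ℝ) = ∑ k, (ξ.w 0 k : ℝ) * (m k - ξ.w 0 k) := by
  simp only [mu, Nat.cast_sum, Nat.cast_mul]
  rw [Finset.sum_comm]
  simp only [← Finset.mul_sum, sum_test_eq]

end ExactDesign

/-- Over the integers, `x * (q - x)` is maximal at `x = ⌊q/2⌋`. -/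
theorem mul_sub_le_half_mul_sub_half (q x : ℕ) :
    (x : ℝ) * (q - x) ≤ ((q / 2 : ℕ) : ℝ) * (q - (q / 2 : ℕ)) := by
  have key : (x : ℤ) * (q - x) ≤ ((q / 2 : ℕ) : ℤ) * (q - (q / 2 : ℕ)) := by
    have h1 : 2 * (q / 2) ≤ q := by omega
    have h2 : q ≤ 2 * (q / 2) + 1 := by omega
    generalize q / 2 = f at *
    zify at h1 h2
    rcases le_or_gt (x : ℤ) f with h | h <;> nlinarith
  have := (Int.cast_le (R := ℝ)).2 key
  simpa only [Int.cast_mul, Int.cast_sub, Int.cast_natCast] using this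

/-- If `ξ ∈ D(v,d,q·1_d)` has `ξ(0,k) = ⌊q/2⌋` in every block, is binary
in the test treatments, and is equireplicated in the test treatments, then
`μ_{01}(ξ) = … = μ_{0v}(ξ)` (each equal to `⌊q/2⌋ · r_1(ξ)`), and consequently `ξ` is
E-optimal in `D(v,d,q·1_d)`. -/
theorem MorganWang_Eopt {v d q : ℕ} (hv : 2 ≤ v) (hd : 1 ≤ d) (hq : 2 ≤ q)
    (ξ : ExactDesign v d (fun _ => q))
    (h0 : ∀ k, ξ.w 0 k = q / 2)
    (hbin : ∀ (i : Fin v) (k : Fin d), ξ.w i.succ k ≤ 1)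
    (hr : ∀ i j : Fin v, ξ.r i.succ = ξ.r j.succ) :
    (∀ i : Fin v, ξ.mu 0 i.succ = (q / 2) * ξ.r i.succ) ∧
    (∀ i j : Fin v, ξ.mu 0 i.succ = ξ.mu 0 j.succ) ∧
    (∀ η : ExactDesign v d (fun _ => q),
      lamMin (ExactDesign.N η) ≤ lamMin (ExactDesign.N ξ)) := by
  have hq0 : q ≠ 0 := by omega
  have hqpos : (0 : ℝ) < q := Nat.cast_pos.2 (by omega)
  have hvpos : (0 : ℝ) < v := Nat.cast_pos.2 (by omega)
  have : NeZero v := ⟨by omega⟩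
  have hmu : ∀ i : Fin v, ξ.mu 0 i.succ = (q / 2) * ξ.r i.succ := fun i => by
    simp only [ExactDesign.mu, ExactDesign.r, h0, Finset.mul_sum]
  have hmu' : ∀ i j : Fin v, ξ.mu 0 i.succ = ξ.mu 0 j.succ := fun i j => by
    rw [hmu, hmu, hr i j]
  refine ⟨hmu, hmu', fun η => ?_⟩
  have hξ : lamMin ξ.N = (ξ.mu 0 (Fin.succ 0) : ℝ) / q :=
    lamMin_eq_of_row_sums (fun _ _ => ξ.N_nonpos_of_ne)
      fun i => by rw [ξ.sum_N_row hq0, hmu' i 0]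
  have hη := lamMin_mul_card_le_sum η.isHermitian_N
  simp only [η.sum_N_row hq0, ← Finset.sum_div, η.sum_mu_control] at hη
  have hsum : (v : ℝ) * ξ.mu 0 (Fin.succ 0) = ∑ k, (ξ.w 0 k : ℝ) * ((q : ℕ) - ξ.w 0 k) := by
    rw [← ξ.sum_mu_control]
    simp [hmu' _ 0]
  have hle : ∑ k, (η.w 0 k : ℝ) * ((q : ℕ) - η.w 0 k) ≤ v * ξ.mu 0 (Fin.succ 0) := by
    rw [hsum]
    exact Finset.sum_le_sum fun k _ => h0 k ▸ mul_sub_le_half_mul_sub_half q _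
  rw [hξ]
  refine le_of_mul_le_mul_right (hη.trans ?_) hvpos
  rw [div_mul_eq_mul_div, mul_comm (ξ.mu _ _ : ℝ)]
  gcongr
end
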